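/- (DKW plus margin bound.) Suppose P_X(0 < |η(X) − θ*| ≤ δ) ≤ c0 δ^α for every δ > 0 with constants c0 > 0, α > 0, and P(Y=1) ≥ p > 0. Let f : ℝ^d → [0,1] be a fixed measurable function, let X_1, …, X_N be i.i.d. with distribution P_X, and set Δ = sup_{t ∈ [0,1]} | P_X(f(X) ≤ t) − (1/N) Σ_{i=1}^N 1{f(X_i) ≤ t} |. Then there exists a constant C'' > 0 depending only on p, α, c0 such that E[ E_{X ~ P_X}[ |η(X) − θ*| · 1{ p |η(X) − θ*| ≤ 4 Δ } ] ] ≤ C'' N^{−(1+α)/2}, where the outer expectation is over X_1, …, X_N. -/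

import Mathlib

/-!
STATEMENT 12 (DKW plus margin bound): under the margin condition
P_X(0 < |η(X) − θ*| ≤ δ) ≤ c0 δ^α (∀ δ > 0) and P(Y=1) ≥ p > 0, for a fixed
measurable f : ℝ^d → [0,1] and X_1, …, X_N i.i.d. ∼ P_X, letting
Δ = sup_{t ∈ [0,1]} |P_X(f(X) ≤ t) − (1/N) Σ_i 1{f(X_i) ≤ t}|, there is C'' > 0
depending only on p, α, c0 with
  E[ E_{X∼P_X}[ |η(X) − θ*| 1{p |η(X) − θ*| ≤ 4Δ} ] ] ≤ C'' N^{−(1+α)/2},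
the outer expectation being over the sample (X_1, …, X_N) ∼ P_X^{⊗N}.
θ* ∈ [0,1] is the unique solution of θ P(Y=1) = E[(η(X) − θ)_+],
P(Y=1) = ∫ η dP_X.
-/

open MeasureTheory Set

/-- The indicator of `u ≤ t`. -/
noncomputable def stepFn (u t : ℝ) : ℝ := if u ≤ t then 1 else 0

lemma stepFn_nonneg (u t : ℝ) : 0 ≤ stepFn u t := by
  unfold stepFn; split_ifs <;> norm_num

lemma stepFn_le_one (u t : ℝ) : stepFn u t ≤ 1 := by
  unfold stepFn; split_ifs <;> norm_num

lemma abs_stepFn_le_one (u t : ℝ) : |stepFn u t| ≤ 1 := by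
  rw [abs_of_nonneg (stepFn_nonneg u t)]; exact stepFn_le_one u t

lemma abs_stepFn_sub_stepFn_le_one (u v t : ℝ) : |stepFn u t - stepFn v t| ≤ 1 :=
  abs_sub_le_iff.2 ⟨by linarith [stepFn_le_one u t, stepFn_nonneg v t],
    by linarith [stepFn_le_one v t, stepFn_nonneg u t]⟩

lemma measurable_stepFn (t : ℝ) : Measurable fun u => stepFn u t :=
  Measurable.ite measurableSet_Iic measurable_const measurable_const

section SignedSums

variable {ι : Type*}

/-- The supremum over rational thresholds `q` of `∑ i ∈ s, c i * 1{x i ≤ q}`. -/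
noncomputable def stepSumSup (x c : ι → ℝ) (s : Finset ι) : ℝ :=
  ⨆ q : ℚ, ∑ i ∈ s, c i * stepFn (x i) q

lemma abs_sum_mul_le {c u : ι → ℝ} (s : Finset ι) (hu : ∀ i, |u i| ≤ 1) :
    |∑ i ∈ s, c i * u i| ≤ ∑ i ∈ s, |c i| := by
  refine (Finset.abs_sum_le_sum_abs _ _).trans (Finset.sum_le_sum fun i _ => ?_)
  rw [abs_mul]
  exact mul_le_of_le_one_right (abs_nonneg _) (hu i)

lemma bddAbove_stepSum (x c : ι → ℝ) (s : Finset ι) :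
    BddAbove (range fun q : ℚ => ∑ i ∈ s, c i * stepFn (x i) q) := by
  refine ⟨∑ i ∈ s, |c i|, ?_⟩
  rintro _ ⟨q, rfl⟩
  exact (le_abs_self _).trans (abs_sum_mul_le s fun i => abs_stepFn_le_one _ _)

lemma le_stepSumSup (x c : ι → ℝ) (s : Finset ι) (q : ℚ) :
    ∑ i ∈ s, c i * stepFn (x i) q ≤ stepSumSup x c s :=
  le_ciSup (bddAbove_stepSum x c s) q

lemma stepSumSup_congr {x c c' : ι → ℝ} {s : Finset ι} (h : ∀ i ∈ s, c i = c' i) :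
    stepSumSup x c s = stepSumSup x c' s := by
  unfold stepSumSup
  congr 1
  ext q
  exact Finset.sum_congr rfl fun i hi => by rw [h i hi]

variable [DecidableEq ι]

lemma stepSumSup_insert_le {x c : ι → ℝ} {s : Finset ι} {a : ι} (ha : a ∉ s)
    (hmin : ∀ i ∈ s, x a ≤ x i) :
    stepSumSup x c (insert a s) ≤ max 0 (c a + stepSumSup x c s) := by
  refine ciSup_le fun q => ?_
  rw [Finset.sum_insert ha]
  by_cases hq : x a ≤ q
  · refine le_max_of_le_right (add_le_add ?_ (le_stepSumSup x c s q))
    simp [stepFn, hq]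
  · refine le_max_of_le_left (le_of_eq ?_)
    rw [Finset.sum_eq_zero, add_zero]
    · simp [stepFn, hq]
    · intro i hi
      have : ¬ x i ≤ q := fun h => hq ((hmin i hi).trans h)
      simp [stepFn, this]

/-- The sign vector which is `σ` on `T` and `-σ` off `T`. -/
def signVec (σ : ℝ) (T : Finset ι) (i : ι) : ℝ := if i ∈ T then σ else -σ

lemma one_add_le_exp_neg_add {y c : ℝ} (hy : 0 ≤ y) (hc : 1 ≤ c) :
    1 + c ≤ Real.exp (-y) + Real.exp y * c := by
  have h1 : 1 ≤ Real.exp y := Real.one_le_exp hy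
  have h2 : Real.exp (-y) * Real.exp y = 1 := by rw [← Real.exp_add]; simp
  have h3 : 0 < Real.exp (-y) := Real.exp_pos _
  have h4 : Real.exp (-y) ≤ 1 := by rw [Real.exp_le_one_iff]; linarith
  nlinarith [mul_nonneg (sub_nonneg.2 h1) (sub_nonneg.2 (h4.trans hc))]

/-- A maximal inequality for the random walk obtained by adding independent signs in the order
given by `x`, in exponential form. -/
lemma sum_powerset_exp_max_stepSumSup_le (x : ι → ℝ) {σ : ℝ} (hσ : σ = 1 ∨ σ = -1)
    {θ : ℝ} (hθ : 0 ≤ θ) (s : Finset ι) (m : ℝ) :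
    ∑ T ∈ s.powerset, Real.exp (θ * max m (stepSumSup x (signVec σ T) s)) ≤
      2 ^ s.card * (Real.exp (θ * m) + Real.exp (-(θ * m)) * Real.cosh (2 * θ) ^ s.card) := by
  induction s using Finset.induction_on_min_value x generalizing m with
  | empty =>
    have h0 : stepSumSup x (signVec σ (∅ : Finset ι)) ∅ = 0 := by simp [stepSumSup]
    simp only [Finset.powerset_empty, Finset.sum_singleton, h0, Finset.card_empty, pow_zero,
      one_mul, mul_one]
    rcases le_total m 0 with hm | hm
    · rw [max_eq_right hm, mul_zero, Real.exp_zero]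
      have := Real.one_le_exp (x := -(θ * m)) (by nlinarith)
      linarith [Real.exp_pos (θ * m)]
    · rw [max_eq_left hm]
      linarith [Real.exp_pos (-(θ * m))]
  | insert a s ha hmin ih =>
    have hc : 1 ≤ Real.cosh (2 * θ) ^ (insert a s).card := one_le_pow₀ (Real.one_le_cosh _)
    wlog hm : 0 ≤ m generalizing m
    · push Not at hm
      calc _ ≤ ∑ T ∈ (insert a s).powerset,
            Real.exp (θ * max 0 (stepSumSup x (signVec σ T) (insert a s))) := by gcongr
        _ ≤ _ := this 0 le_rfl
        _ ≤ _ := by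
          have := one_add_le_exp_neg_add (y := -(θ * m)) (by nlinarith) hc
          rw [neg_neg] at this
          simp only [mul_zero, Real.exp_zero, neg_zero, one_mul]
          gcongr
    have key : ∀ (c : ι → ℝ), Real.exp (θ * max m (stepSumSup x c (insert a s))) ≤
        Real.exp (θ * c a) * Real.exp (θ * max (m - c a) (stepSumSup x c s)) := by
      intro c
      rw [← Real.exp_add, ← mul_add, ← max_add_add_left]
      refine Real.exp_le_exp.2 (mul_le_mul_of_nonneg_left ?_ hθ)
      refine max_le (le_max_of_le_left (by linarith))
        ((stepSumSup_insert_le ha hmin).trans (max_le ?_ (le_max_right _ _)))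
      exact le_max_of_le_left (by linarith)
    have hout : ∑ T ∈ s.powerset,
          Real.exp (θ * max m (stepSumSup x (signVec σ T) (insert a s))) ≤
        Real.exp (θ * -σ) * ∑ T ∈ s.powerset,
          Real.exp (θ * max (m - -σ) (stepSumSup x (signVec σ T) s)) := by
      rw [Finset.mul_sum]
      refine Finset.sum_le_sum fun T hT => (key _).trans_eq ?_
      have haT : a ∉ T := fun h => ha (Finset.mem_powerset.1 hT h)
      simp [signVec, haT]
    have hin : ∑ T ∈ s.powerset,
          Real.exp (θ * max m (stepSumSup x (signVec σ (insert a T)) (insert a s))) ≤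
        Real.exp (θ * σ) * ∑ T ∈ s.powerset,
          Real.exp (θ * max (m - σ) (stepSumSup x (signVec σ T) s)) := by
      rw [Finset.mul_sum]
      refine Finset.sum_le_sum fun T hT => (key _).trans_eq ?_
      have hca : signVec σ (insert a T) a = σ := by simp [signVec]
      rw [hca, stepSumSup_congr (c' := signVec σ T)]
      intro i hi
      have : i ≠ a := fun h => ha (h ▸ hi)
      simp [signVec, this]
    rw [Finset.sum_powerset_insert ha, Finset.card_insert_of_notMem ha]
    have hstep : ∀ τ : ℝ, Real.exp (θ * τ) * ∑ T ∈ s.powerset,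
          Real.exp (θ * max (m - τ) (stepSumSup x (signVec σ T) s)) ≤
        2 ^ s.card * (Real.exp (θ * m) +
          Real.exp (-(θ * m)) * Real.exp (2 * θ * τ) * Real.cosh (2 * θ) ^ s.card) := by
      intro τ
      refine (mul_le_mul_of_nonneg_left (ih (m - τ)) (Real.exp_pos _).le).trans_eq ?_
      have e1 : Real.exp (θ * m) = Real.exp (θ * τ) * Real.exp (θ * (m - τ)) := by
        rw [← Real.exp_add]; ring_nf
      have e2 : Real.exp (-(θ * m)) * Real.exp (2 * θ * τ) =
          Real.exp (θ * τ) * Real.exp (-(θ * (m - τ))) := by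
        rw [← Real.exp_add, ← Real.exp_add]; ring_nf
      rw [e1, e2]
      ring
    have hcosh : Real.exp (2 * θ * -σ) + Real.exp (2 * θ * σ) = 2 * Real.cosh (2 * θ) := by
      rw [Real.cosh_eq]
      rcases hσ with rfl | rfl <;> simp <;> ring
    calc _ ≤ _ := add_le_add (hout.trans (hstep _)) (hin.trans (hstep _))
      _ = 2 ^ s.card * (2 * Real.exp (θ * m) + Real.exp (-(θ * m)) *
          (Real.exp (2 * θ * -σ) + Real.exp (2 * θ * σ)) * Real.cosh (2 * θ) ^ s.card) := by ring
      _ = _ := by rw [hcosh]; ring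

lemma signVec_neg (σ : ℝ) (T : Finset ι) : signVec (-σ) T = -signVec σ T := by
  ext i
  simp only [signVec, Pi.neg_apply]
  split_ifs <;> rfl

/-- The exponential moment of the Kolmogorov-type supremum of a Rademacher sum of steps. -/
lemma sum_powerset_exp_iSup_abs_le (x : ι → ℝ) {θ : ℝ} (hθ : 0 ≤ θ) (s : Finset ι) :
    ∑ T ∈ s.powerset, Real.exp (θ * ⨆ q : ℚ, |∑ i ∈ s, signVec 1 T i * stepFn (x i) q|) ≤
      2 ^ s.card * (2 * (1 + Real.cosh (2 * θ) ^ s.card)) := by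
  have h (σ : ℝ) (hσ : σ = 1 ∨ σ = -1) := sum_powerset_exp_max_stepSumSup_le x hσ hθ s 0
  simp only [mul_zero, Real.exp_zero, neg_zero, one_mul] at h
  calc _ ≤ ∑ T ∈ s.powerset, (Real.exp (θ * max 0 (stepSumSup x (signVec 1 T) s)) +
        Real.exp (θ * max 0 (stepSumSup x (signVec (-1) T) s))) := by
        refine Finset.sum_le_sum fun T _ => ?_
        set A := max 0 (stepSumSup x (signVec 1 T) s)
        set B := max 0 (stepSumSup x (signVec (-1) T) s)
        have hAB : ⨆ q : ℚ, |∑ i ∈ s, signVec 1 T i * stepFn (x i) q| ≤ max A B := by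
          refine ciSup_le fun q => abs_le'.2 ⟨?_, ?_⟩
          · exact le_max_of_le_left (le_max_of_le_right (le_stepSumSup x _ s q))
          · refine le_max_of_le_right (le_max_of_le_right (le_trans (le_of_eq ?_)
              (le_stepSumSup x (signVec (-1) T) s q)))
            simp [signVec_neg, Finset.sum_neg_distrib]
        refine (Real.exp_le_exp.2 (mul_le_mul_of_nonneg_left hAB hθ)).trans ?_
        rcases max_choice A B with e | e <;> rw [e] <;>
          linarith [Real.exp_pos (θ * A), Real.exp_pos (θ * B)]
    _ ≤ _ := by
        rw [Finset.sum_add_distrib]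
        linarith [h 1 (Or.inl rfl), h (-1) (Or.inr rfl)]

/-- The two-sample version of `sum_powerset_exp_iSup_abs_le`. -/
lemma sum_powerset_exp_iSup_abs_sub_le (x y : ι → ℝ) {θ : ℝ} (hθ : 0 ≤ θ) (s : Finset ι) :
    ∑ T ∈ s.powerset, Real.exp (θ * ⨆ q : ℚ,
        |∑ i ∈ s, signVec 1 T i * (stepFn (x i) q - stepFn (y i) q)|) ≤
      2 ^ s.card * (2 * (1 + Real.cosh (4 * θ) ^ s.card)) := by
  have hx := sum_powerset_exp_iSup_abs_le x (θ := 2 * θ) (by positivity) s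
  have hy := sum_powerset_exp_iSup_abs_le y (θ := 2 * θ) (by positivity) s
  rw [show 2 * (2 * θ) = 4 * θ by ring] at hx hy
  set U := fun (x : ι → ℝ) (T : Finset ι) => ⨆ q : ℚ, |∑ i ∈ s, signVec 1 T i * stepFn (x i) q|
    with hU
  have hle (x : ι → ℝ) (T : Finset ι) (q : ℚ) :
      |∑ i ∈ s, signVec 1 T i * stepFn (x i) q| ≤ U x T := by
    refine le_ciSup (f := fun q : ℚ => |∑ i ∈ s, signVec 1 T i * stepFn (x i) q|)
      ⟨∑ i ∈ s, |signVec 1 T i|, ?_⟩ q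
    rintro _ ⟨q, rfl⟩
    exact abs_sum_mul_le s fun i => abs_stepFn_le_one _ _
  have hpt : ∀ T ∈ s.powerset, Real.exp (θ * ⨆ q : ℚ,
        |∑ i ∈ s, signVec 1 T i * (stepFn (x i) q - stepFn (y i) q)|) ≤
      (Real.exp (2 * θ * U x T) + Real.exp (2 * θ * U y T)) / 2 := by
    intro T _
    have h1 : ⨆ q : ℚ, |∑ i ∈ s, signVec 1 T i * (stepFn (x i) q - stepFn (y i) q)| ≤
        U x T + U y T := by
      refine ciSup_le fun q => ?_
      simp only [mul_sub, Finset.sum_sub_distrib]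
      exact (abs_sub _ _).trans (add_le_add (hle x T q) (hle y T q))
    refine (Real.exp_le_exp.2 (mul_le_mul_of_nonneg_left h1 hθ)).trans ?_
    have e1 : Real.exp (2 * θ * U x T) = Real.exp (θ * U x T) ^ 2 := by
      rw [← Real.exp_nat_mul]; push_cast; ring_nf
    have e2 : Real.exp (2 * θ * U y T) = Real.exp (θ * U y T) ^ 2 := by
      rw [← Real.exp_nat_mul]; push_cast; ring_nf
    rw [mul_add, Real.exp_add, e1, e2]
    nlinarith [sq_nonneg (Real.exp (θ * U x T) - Real.exp (θ * U y T))]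
  refine (Finset.sum_le_sum hpt).trans ?_
  rw [← Finset.sum_div, Finset.sum_add_distrib]
  linarith

end SignedSums

section Symmetrization

variable {Ω ι : Type*} [Fintype ι]

/-- The supremum over rational thresholds of the signed difference of the two counting functions
of a paired sample. -/
noncomputable def pairedDeviation (f : Ω → ℝ) (c : ι → ℝ) (w : ι → Ω × Ω) : ℝ :=
  ⨆ q : ℚ, |∑ i, c i * (stepFn (f (w i).1) q - stepFn (f (w i).2) q)|

lemma abs_pairedSum_le (f : Ω → ℝ) (c : ι → ℝ) (w : ι → Ω × Ω) (q : ℚ) :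
    |∑ i, c i * (stepFn (f (w i).1) q - stepFn (f (w i).2) q)| ≤ ∑ i, |c i| :=
  abs_sum_mul_le _ fun _ => abs_stepFn_sub_stepFn_le_one _ _ _

lemma le_pairedDeviation (f : Ω → ℝ) (c : ι → ℝ) (w : ι → Ω × Ω) (q : ℚ) :
    |∑ i, c i * (stepFn (f (w i).1) q - stepFn (f (w i).2) q)| ≤ pairedDeviation f c w := by
  refine le_ciSup
    (f := fun q : ℚ => |∑ i, c i * (stepFn (f (w i).1) q - stepFn (f (w i).2) q)|)
    ⟨∑ i, |c i|, ?_⟩ q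
  rintro _ ⟨q, rfl⟩
  exact abs_pairedSum_le f c w q

lemma pairedDeviation_nonneg (f : Ω → ℝ) (c : ι → ℝ) (w : ι → Ω × Ω) :
    0 ≤ pairedDeviation f c w :=
  (abs_nonneg _).trans (le_pairedDeviation f c w 0)

lemma pairedDeviation_le (f : Ω → ℝ) (c : ι → ℝ) (w : ι → Ω × Ω) :
    pairedDeviation f c w ≤ ∑ i, |c i| :=
  ciSup_le fun q => abs_pairedSum_le f c w q

variable [MeasurableSpace Ω] {μ : Measure Ω} [IsProbabilityMeasure μ] {f : Ω → ℝ}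

lemma measurable_pairedDeviation (hf : Measurable f) (c : ι → ℝ) :
    Measurable (pairedDeviation f c) := by
  refine Measurable.iSup fun q => ?_
  have hs := (measurable_stepFn q).comp hf
  have h : ∀ i, Measurable fun w : ι → Ω × Ω =>
      c i * (stepFn (f (w i).1) q - stepFn (f (w i).2) q) := fun i =>
    ((hs.comp (measurable_fst.comp (measurable_pi_apply i))).sub
      (hs.comp (measurable_snd.comp (measurable_pi_apply i)))).const_mul _
  exact measurable_norm.comp (Finset.measurable_sum _ fun i _ => h i)

lemma integrable_exp_mul_of_bound {α : Type*} [MeasurableSpace α] {ρ : Measure α}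
    [IsFiniteMeasure ρ] {g : α → ℝ} (hg : Measurable g) {B θ : ℝ} (hθ : 0 ≤ θ)
    (hB : ∀ a, g a ≤ B) : Integrable (fun a => Real.exp (θ * g a)) ρ := by
  refine Integrable.of_bound (Real.measurable_exp.comp (hg.const_mul θ)).aestronglyMeasurable
    (Real.exp (θ * B)) (ae_of_all _ fun a => ?_)
  rw [Real.norm_eq_abs, Real.abs_exp]
  exact Real.exp_le_exp.2 (mul_le_mul_of_nonneg_left (hB a) hθ)

variable [DecidableEq ι]

/-- Exchanging the two members of the pairs outside `T` does not change the law of the paired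
deviation. -/
lemma integral_exp_pairedDeviation_one (hf : Measurable f) (θ : ℝ) (T : Finset ι) :
    ∫ w, Real.exp (θ * pairedDeviation f (fun _ => 1) w) ∂(Measure.pi fun _ : ι => μ.prod μ) =
      ∫ w, Real.exp (θ * pairedDeviation f (signVec 1 T) w)
        ∂(Measure.pi fun _ : ι => μ.prod μ) := by
  let φ : ι → Ω × Ω → Ω × Ω := fun i => if i ∈ T then id else Prod.swap
  have hφ : MeasurePreserving (fun (w : ι → Ω × Ω) i => φ i (w i))
      (Measure.pi fun _ : ι => μ.prod μ) (Measure.pi fun _ : ι => μ.prod μ) := by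
    refine measurePreserving_pi _ _ fun i => ?_
    by_cases hi : i ∈ T
    · simpa [φ, hi] using MeasurePreserving.id (μ.prod μ)
    · simpa [φ, hi] using Measure.measurePreserving_swap (μ := μ) (ν := μ)
  have hm : Measurable fun w : ι → Ω × Ω => Real.exp (θ * pairedDeviation f (fun _ => 1) w) :=
    Real.measurable_exp.comp ((measurable_pairedDeviation hf _).const_mul θ)
  rw [← hφ.map_eq, integral_map hφ.measurable.aemeasurable hm.aestronglyMeasurable, hφ.map_eq]
  refine integral_congr_ae (ae_of_all _ fun w => ?_)
  have : pairedDeviation f (fun _ => 1) (fun i => φ i (w i)) =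
      pairedDeviation f (signVec 1 T) w := by
    unfold pairedDeviation
    congr 1
    ext q
    congr 1
    refine Finset.sum_congr rfl fun i _ => ?_
    by_cases hi : i ∈ T
    · simp [φ, signVec, hi]
    · simp [φ, signVec, hi]
  simp only [this]

lemma integral_exp_pairedDeviation_le (hf : Measurable f) {θ : ℝ} (hθ : 0 ≤ θ) :
    ∫ w, Real.exp (θ * pairedDeviation f (fun _ => 1) w) ∂(Measure.pi fun _ : ι => μ.prod μ) ≤
      2 * (1 + Real.cosh (4 * θ) ^ Fintype.card ι) := by
  set ρ := Measure.pi fun _ : ι => μ.prod μ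
  set s : Finset ι := Finset.univ
  have hint (T : Finset ι) :
      Integrable (fun w => Real.exp (θ * pairedDeviation f (signVec 1 T) w)) ρ :=
    integrable_exp_mul_of_bound (measurable_pairedDeviation hf _) hθ
      (pairedDeviation_le f (signVec 1 T))
  have h1 : ∑ T ∈ s.powerset,
      ∫ w, Real.exp (θ * pairedDeviation f (fun _ => 1) w) ∂ρ =
      ∫ w, ∑ T ∈ s.powerset, Real.exp (θ * pairedDeviation f (signVec 1 T) w) ∂ρ := by
    rw [integral_finsetSum _ fun T _ => hint T]
    exact Finset.sum_congr rfl fun T _ => integral_exp_pairedDeviation_one hf θ T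
  have h2 : ∫ w, ∑ T ∈ s.powerset, Real.exp (θ * pairedDeviation f (signVec 1 T) w) ∂ρ ≤
      ∫ _, 2 ^ s.card * (2 * (1 + Real.cosh (4 * θ) ^ s.card)) ∂ρ :=
    integral_mono (integrable_finsetSum _ fun T _ => hint T) (integrable_const _) fun w =>
      sum_powerset_exp_iSup_abs_sub_le (fun i => f (w i).1) (fun i => f (w i).2) hθ s
  rw [← h1, Finset.sum_const, Finset.card_powerset, integral_const, probReal_univ, one_smul,
    nsmul_eq_mul] at h2
  push_cast at h2
  exact le_of_mul_le_mul_left h2 (by positivity)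

end Symmetrization

section EmpiricalProcess

variable {Ω ι : Type*} [Fintype ι] [MeasurableSpace Ω] {μ : Measure Ω} {f : Ω → ℝ}

/-- The supremum over rational thresholds of the deviation of the counting function of a sample
from its mean. -/
noncomputable def centeredDeviation (μ : Measure Ω) (f : Ω → ℝ) (s : ι → Ω) : ℝ :=
  ⨆ q : ℚ, |∑ i, (stepFn (f (s i)) q - μ.real {y | f y ≤ q})|

lemma integral_stepFn (hf : Measurable f) (t : ℝ) :
    ∫ y, stepFn (f y) t ∂μ = μ.real {y | f y ≤ t} := by
  have : (fun y => stepFn (f y) t) = {y | f y ≤ t}.indicator fun _ => 1 := by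
    ext y; simp [stepFn, indicator]
  have hm : MeasurableSet {y | f y ≤ t} := hf measurableSet_Iic
  rw [this]
  exact (integral_indicator_const _ hm).trans (by simp)

lemma measurable_centeredDeviation (hf : Measurable f) :
    Measurable (centeredDeviation (ι := ι) μ f) := by
  refine Measurable.iSup fun q => ?_
  have h : ∀ i, Measurable fun s : ι → Ω => stepFn (f (s i)) q - μ.real {y | f y ≤ q} := fun i =>
    (((measurable_stepFn q).comp hf).comp (measurable_pi_apply i)).sub_const _
  exact measurable_norm.comp (Finset.measurable_sum _ fun i _ => h i)

variable [IsProbabilityMeasure μ]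

lemma abs_centeredSum_le (s : ι → Ω) (t : ℝ) :
    |∑ i, (stepFn (f (s i)) t - μ.real {y | f y ≤ t})| ≤ Fintype.card ι := by
  refine (Finset.abs_sum_le_sum_abs _ _).trans ?_
  refine (Finset.sum_le_card_nsmul _ _ 1 fun i _ => ?_).trans (by simp)
  have h1 : μ.real {y | f y ≤ t} ≤ 1 := measureReal_le_one
  have h0 : 0 ≤ μ.real {y | f y ≤ t} := measureReal_nonneg
  exact abs_sub_le_iff.2 ⟨by linarith [stepFn_le_one (f (s i)) t],
    by linarith [stepFn_nonneg (f (s i)) t]⟩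

lemma le_centeredDeviation (s : ι → Ω) (q : ℚ) :
    |∑ i, (stepFn (f (s i)) q - μ.real {y | f y ≤ q})| ≤ centeredDeviation μ f s := by
  refine le_ciSup (f := fun q : ℚ => |∑ i, (stepFn (f (s i)) q - μ.real {y | f y ≤ q})|)
    ⟨Fintype.card ι, ?_⟩ q
  rintro _ ⟨q, rfl⟩
  exact abs_centeredSum_le s q

lemma centeredDeviation_le (s : ι → Ω) : centeredDeviation μ f s ≤ Fintype.card ι :=
  ciSup_le fun q => abs_centeredSum_le s q

lemma centeredDeviation_le_integral (hf : Measurable f) (s : ι → Ω) :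
    centeredDeviation μ f s ≤
      ∫ s', pairedDeviation f (fun _ => 1) (fun i => (s i, s' i)) ∂(Measure.pi fun _ : ι => μ) := by
  have hpair : Measurable fun s' : ι → Ω => fun i => (s i, s' i) :=
    measurable_pi_lambda _ fun i => measurable_const.prodMk (measurable_pi_apply i)
  have hD : Integrable (fun s' : ι → Ω => pairedDeviation f (fun _ => 1) (fun i => (s i, s' i)))
      (Measure.pi fun _ : ι => μ) := by
    refine Integrable.of_bound
      ((measurable_pairedDeviation hf _).comp hpair).aestronglyMeasurable
      (∑ _i : ι, |(1 : ℝ)|) (ae_of_all _ fun s' => ?_)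
    rw [Real.norm_of_nonneg (pairedDeviation_nonneg _ _ _)]
    exact pairedDeviation_le _ _ _
  refine ciSup_le fun q => ?_
  have hint (i : ι) : Integrable (fun s' : ι → Ω => stepFn (f (s' i)) q)
      (Measure.pi fun _ : ι => μ) :=
    Integrable.of_bound (((measurable_stepFn q).comp hf).comp
      (measurable_pi_apply i)).aestronglyMeasurable 1
      (ae_of_all _ fun s' => abs_stepFn_le_one _ _)
  have hmean : ∑ i, (stepFn (f (s i)) q - μ.real {y | f y ≤ q}) =
      ∫ s', ∑ i, (1 : ℝ) * (stepFn (f (s i)) q - stepFn (f (s' i)) q)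
        ∂(Measure.pi fun _ : ι => μ) := by
    simp only [one_mul]
    have hsub : ∀ i, Integrable (fun s' : ι → Ω => stepFn (f (s i)) q - stepFn (f (s' i)) q)
        (Measure.pi fun _ : ι => μ) := fun i => (integrable_const _).sub (hint i)
    rw [integral_finsetSum _ fun i _ => hsub i]
    refine Finset.sum_congr rfl fun i _ => ?_
    rw [integral_sub (integrable_const _) (hint i), integral_const, probReal_univ, one_smul,
      integral_comp_eval (μ := fun _ : ι => μ) (i := i) (f := fun y => stepFn (f y) q)
        ((measurable_stepFn q).comp hf).aestronglyMeasurable, integral_stepFn hf]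
  rw [hmean]
  refine abs_integral_le_integral_abs.trans
    (integral_mono_of_nonneg (ae_of_all _ fun _ => abs_nonneg _) hD (ae_of_all _ fun s' => ?_))
  exact le_pairedDeviation f (fun _ => 1) (fun i => (s i, s' i)) q

lemma integral_integral_pi {F : (ι → Ω × Ω) → ℝ}
    (hF : Integrable (fun z : (ι → Ω) × (ι → Ω) => F fun i => (z.1 i, z.2 i))
      ((Measure.pi fun _ : ι => μ).prod (Measure.pi fun _ : ι => μ))) :
    ∫ s, ∫ s', F (fun i => (s i, s' i)) ∂(Measure.pi fun _ : ι => μ)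
        ∂(Measure.pi fun _ : ι => μ) =
      ∫ w, F w ∂(Measure.pi fun _ : ι => μ.prod μ) :=
  (integral_prod _ hF).symm.trans
    ((measurePreserving_arrowProdEquivProdArrow Ω Ω ι (fun _ => μ) (fun _ => μ)).integral_comp'
      fun z => F fun i => (z.1 i, z.2 i)).symm

lemma exp_mul_integral_le {α : Type*} [MeasurableSpace α] {ρ : Measure α}
    [IsProbabilityMeasure ρ] {g : α → ℝ} {θ : ℝ} (hg : Integrable g ρ)
    (hexp : Integrable (fun a => Real.exp (θ * g a)) ρ) :
    Real.exp (θ * ∫ a, g a ∂ρ) ≤ ∫ a, Real.exp (θ * g a) ∂ρ := by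
  rw [← integral_const_mul]
  exact convexOn_exp.map_integral_le Real.continuous_exp.continuousOn isClosed_univ
    (ae_of_all _ fun _ => mem_univ _) (hg.const_mul θ) hexp

/-- Exponential moment bound for the empirical process indexed by half-lines. -/
lemma integral_exp_centeredDeviation_le (hf : Measurable f) {θ : ℝ} (hθ : 0 ≤ θ) :
    ∫ s, Real.exp (θ * centeredDeviation μ f s) ∂(Measure.pi fun _ : ι => μ) ≤
      2 * (1 + Real.cosh (4 * θ) ^ Fintype.card ι) := by
  classical
  set π := Measure.pi fun _ : ι => μ
  let D : (ι → Ω) → (ι → Ω) → ℝ := fun s s' =>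
    pairedDeviation f (fun _ => 1) (fun i => (s i, s' i))
  have hDm : Measurable fun z : (ι → Ω) × (ι → Ω) => D z.1 z.2 :=
    by
    have hpair : Measurable fun (z : (ι → Ω) × (ι → Ω)) i => (z.1 i, z.2 i) :=
      measurable_pi_lambda _ fun i => ((measurable_pi_apply i).comp measurable_fst).prodMk
        ((measurable_pi_apply i).comp measurable_snd)
    exact (measurable_pairedDeviation hf fun _ => 1).comp hpair
  have hDle (s s' : ι → Ω) : D s s' ≤ ∑ _i : ι, |(1 : ℝ)| :=
    pairedDeviation_le f (fun _ => 1) fun i => (s i, s' i)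
  have hDs (s : ι → Ω) : Measurable (D s) := by
    have hpair : Measurable fun (s' : ι → Ω) i => (s i, s' i) :=
      measurable_pi_lambda _ fun i => measurable_const.prodMk (measurable_pi_apply i)
    exact (measurable_pairedDeviation hf fun _ => 1).comp hpair
  have hDint (s : ι → Ω) : Integrable (D s) π := by
    refine Integrable.of_bound (hDs s).aestronglyMeasurable
      (∑ _i : ι, |(1 : ℝ)|) (ae_of_all _ fun s' => ?_)
    rw [Real.norm_of_nonneg (pairedDeviation_nonneg _ _ _)]
    exact hDle s s'
  have hexp : Integrable (fun z : (ι → Ω) × (ι → Ω) => Real.exp (θ * D z.1 z.2)) (π.prod π) :=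
    integrable_exp_mul_of_bound hDm hθ fun z => hDle z.1 z.2
  have hjensen (s : ι → Ω) : Real.exp (θ * centeredDeviation μ f s) ≤
      ∫ s', Real.exp (θ * D s s') ∂π := by
    refine (Real.exp_le_exp.2 (mul_le_mul_of_nonneg_left
      (centeredDeviation_le_integral hf s) hθ)).trans ?_
    exact exp_mul_integral_le (hDint s) (integrable_exp_mul_of_bound (hDs s) hθ (hDle s))
  calc _ ≤ ∫ s, ∫ s', Real.exp (θ * D s s') ∂π ∂π :=
        integral_mono (integrable_exp_mul_of_bound (measurable_centeredDeviation hf) hθ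
          centeredDeviation_le) hexp.integral_prod_left hjensen
    _ = ∫ w, Real.exp (θ * pairedDeviation f (fun _ => 1) w)
          ∂(Measure.pi fun _ : ι => μ.prod μ) :=
        integral_integral_pi (F := fun w => Real.exp (θ * pairedDeviation f (fun _ => 1) w)) hexp
    _ ≤ _ := integral_exp_pairedDeviation_le hf hθ

/-- By right-continuity, the deviation at a real threshold is controlled by the rational ones. -/
lemma abs_centeredSum_le_centeredDeviation (hf : Measurable f) (s : ι → Ω) (t : ℝ) :
    |∑ i, (stepFn (f (s i)) t - μ.real {y | f y ≤ t})| ≤ centeredDeviation μ f s := by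
  obtain ⟨u, hanti, hlt, hu⟩ := Real.exists_seq_rat_strictAnti_tendsto t
  have hstep (x : ℝ) : Filter.Tendsto (fun n => stepFn x (u n)) Filter.atTop
      (nhds (stepFn x t)) := by
    by_cases hx : x ≤ t
    · have (n : ℕ) : x ≤ u n := hx.trans (hlt n).le
      simp [stepFn, hx, this]
    · refine tendsto_const_nhds.congr' ?_
      filter_upwards [hu.eventually_lt_const (not_le.1 hx)] with n hn
      simp [stepFn, hx, not_le.2 hn]
  have hF : Filter.Tendsto (fun n => μ.real {y | f y ≤ u n}) Filter.atTop
      (nhds (μ.real {y | f y ≤ t})) := by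
    simp only [← integral_stepFn hf]
    exact tendsto_integral_of_dominated_convergence (fun _ => 1)
      (fun n => ((measurable_stepFn _).comp hf).aestronglyMeasurable) (integrable_const _)
      (fun n => ae_of_all _ fun y => abs_stepFn_le_one _ _) (ae_of_all _ fun y => hstep (f y))
  exact le_of_tendsto (tendsto_finsetSum _ fun i _ => (hstep (f (s i))).sub hF).abs
    (Filter.Eventually.of_forall fun n => le_centeredDeviation s (u n))

end EmpiricalProcess

/-- The margin condition bounds the mass of `|g|` on a sublevel set of `|g|`. -/
lemma setIntegral_abs_le_of_margin {Ω : Type*} [MeasurableSpace Ω] {μ : Measure Ω}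
    [IsProbabilityMeasure μ] {g : Ω → ℝ} (hg : Measurable g) {c α : ℝ} (hc : 0 ≤ c)
    (hmargin : ∀ δ > (0 : ℝ), (μ {x | 0 < |g x| ∧ |g x| ≤ δ}).toReal ≤ c * δ ^ α)
    {D : ℝ} (hD : 0 ≤ D) :
    ∫ x in {x | |g x| ≤ D}, |g x| ∂μ ≤ c * D ^ (1 + α) := by
  have habs : Measurable fun x => |g x| := measurable_norm.comp hg
  have hS : MeasurableSet {x | |g x| ≤ D} := habs measurableSet_Iic
  have hE : MeasurableSet {x | 0 < |g x| ∧ |g x| ≤ D} :=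
    (habs measurableSet_Ioi).inter hS
  have hle : ∫ x in {x | |g x| ≤ D}, |g x| ∂μ ≤
      D * (μ {x | 0 < |g x| ∧ |g x| ≤ D}).toReal := by
    rw [← integral_indicator hS]
    calc _ ≤ ∫ x, {x | 0 < |g x| ∧ |g x| ≤ D}.indicator (fun _ => D) x ∂μ := by
          refine integral_mono_of_nonneg
            (ae_of_all _ fun x => indicator_nonneg (fun _ _ => abs_nonneg _) x)
            ((integrable_const D).indicator hE) (ae_of_all _ fun x => ?_)
          by_cases h1 : |g x| ≤ D
          · rcases (abs_nonneg (g x)).eq_or_lt with h0 | h0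
            · refine le_trans (le_of_eq ?_) (indicator_nonneg (fun _ _ => hD) x)
              simp [indicator, ← h0]
            · simp [indicator, h1, abs_pos.1 h0]
          · simp [indicator, h1]
      _ = _ := by
          rw [integral_indicator_const _ hE, smul_eq_mul, mul_comm]
          rfl
  refine hle.trans ?_
  rcases hD.eq_or_lt with rfl | hpos
  · rw [zero_mul]
    positivity
  · calc _ ≤ D * (c * D ^ α) := mul_le_mul_of_nonneg_left (hmargin D hpos) hD
      _ = _ := by rw [Real.rpow_add hpos, Real.rpow_one]; ring

lemma rpow_le_rpow_self_mul_exp {x a : ℝ} (hx : 0 ≤ x) (ha : 0 < a) :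
    x ^ a ≤ a ^ a * Real.exp x := by
  have h : x / a ≤ Real.exp (x / a) := by linarith [Real.add_one_le_exp (x / a)]
  calc x ^ a = a ^ a * (x / a) ^ a := by
        rw [← Real.mul_rpow ha.le (by positivity), mul_div_cancel₀ _ ha.ne']
    _ ≤ a ^ a * Real.exp (x / a) ^ a := by gcongr
    _ = a ^ a * Real.exp x := by rw [← Real.exp_mul, div_mul_cancel₀ _ ha.ne']

theorem statement12 (p α c0 : ℝ) (hp : 0 < p) (hα : 0 < α) (hc0 : 0 < c0) :
    ∃ C'' > (0 : ℝ), ∀ (d : ℕ) (μ : Measure (EuclideanSpace ℝ (Fin d)))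
      (_ : IsProbabilityMeasure μ)
      (η f : EuclideanSpace ℝ (Fin d) → ℝ) (θstar : ℝ) (N : ℕ),
      1 ≤ N →
      Measurable η → (∀ x, η x ∈ Icc (0 : ℝ) 1) →
      Measurable f → (∀ x, f x ∈ Icc (0 : ℝ) 1) →
      p ≤ ∫ x, η x ∂μ →
      θstar ∈ Icc (0 : ℝ) 1 →
      θstar * ∫ x, η x ∂μ = ∫ x, max (η x - θstar) 0 ∂μ →
      (∀ δ > (0 : ℝ),
        (μ {x | 0 < |η x - θstar| ∧ |η x - θstar| ≤ δ}).toReal ≤ c0 * δ ^ α) →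
      ∫ s, (∫ x in {x | p * |η x - θstar| ≤
              4 * ⨆ t : Icc (0 : ℝ) 1,
                |(μ {y | f y ≤ (t : ℝ)}).toReal -
                  (1 / (N : ℝ)) * ∑ i : Fin N, if f (s i) ≤ (t : ℝ) then 1 else 0|},
            |η x - θstar| ∂μ)
          ∂(Measure.pi fun _ : Fin N => μ) ≤ C'' * (N : ℝ) ^ (-(1 + α) / 2) := by
  set a : ℝ := 1 + α with ha_def
  have ha : 0 < a := by positivity
  refine ⟨c0 * (4 / p) ^ a * a ^ a * (2 * (1 + Real.exp 8)), by positivity, ?_⟩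
  intro d μ hμ η f θstar N hN hη _ hf _ _ _ _ hmargin
  have hN0 : (0 : ℝ) < N := by exact_mod_cast hN
  set θ : ℝ := (√N)⁻¹ with hθ_def
  have hθ : 0 < θ := by positivity
  have hθsq : θ ^ 2 * N = 1 := by
    rw [hθ_def, inv_pow, Real.sq_sqrt hN0.le, inv_mul_cancel₀ hN0.ne']
  have hNθ : θ ^ a = (N : ℝ) ^ (-(1 + α) / 2) := by
    rw [hθ_def, Real.sqrt_eq_rpow, ← Real.rpow_neg hN0.le, ← Real.rpow_mul hN0.le]
    congr 1
    rw [ha_def]; ring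
  have hpt (s : Fin N → EuclideanSpace ℝ (Fin d)) :
      (∫ x in {x | p * |η x - θstar| ≤
              4 * ⨆ t : Icc (0 : ℝ) 1,
                |(μ {y | f y ≤ (t : ℝ)}).toReal -
                  (1 / (N : ℝ)) * ∑ i : Fin N, if f (s i) ≤ (t : ℝ) then 1 else 0|},
            |η x - θstar| ∂μ) ≤
      c0 * (4 / p) ^ a * a ^ a * (N : ℝ) ^ (-(1 + α) / 2) *
        Real.exp (θ * centeredDeviation μ f s) := by
    set Δ := ⨆ t : Icc (0 : ℝ) 1,
      |(μ {y | f y ≤ (t : ℝ)}).toReal -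
        (1 / (N : ℝ)) * ∑ i : Fin N, if f (s i) ≤ (t : ℝ) then 1 else 0| with hΔ
    have hΔ0 : 0 ≤ Δ := Real.iSup_nonneg fun t => abs_nonneg _
    set Z := centeredDeviation μ f s
    have hΔZ : Δ ≤ θ * (θ * Z) := by
      refine ciSup_le fun t => ?_
      have h := abs_centeredSum_le_centeredDeviation (μ := μ) hf s t
      have e : (μ {y | f y ≤ (t : ℝ)}).toReal -
          (1 / (N : ℝ)) * ∑ i : Fin N, (if f (s i) ≤ (t : ℝ) then (1 : ℝ) else 0) =
          -(θ ^ 2 * ∑ i, (stepFn (f (s i)) t - μ.real {y | f y ≤ (t : ℝ)})) := by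
        have hθN : 1 / (N : ℝ) = θ ^ 2 := by rw [div_eq_iff hN0.ne', hθsq]
        rw [Finset.sum_sub_distrib, Finset.sum_const, Finset.card_univ, Fintype.card_fin,
          nsmul_eq_mul, mul_sub, ← mul_assoc, hθsq, hθN]
        simp only [stepFn, Measure.real]
        ring
      rw [e, abs_neg, abs_mul, abs_of_nonneg (sq_nonneg θ), ← mul_assoc, ← sq]
      exact mul_le_mul_of_nonneg_left h (sq_nonneg θ)
    have hZ0 : 0 ≤ θ * Z := nonneg_of_mul_nonneg_right (hΔ0.trans hΔZ) hθ
    have hset : {x | p * |η x - θstar| ≤ 4 * Δ} = {x | |η x - θstar| ≤ 4 / p * Δ} := by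
      ext x
      rw [mem_ofPred_eq, mem_ofPred_eq, div_mul_eq_mul_div, le_div_iff₀ hp, mul_comm p]
    rw [hset]
    calc _ ≤ c0 * (4 / p * Δ) ^ a :=
          setIntegral_abs_le_of_margin (hη.sub_const θstar) hc0.le hmargin (by positivity)
      _ ≤ c0 * (4 / p * (θ * (θ * Z))) ^ a := by gcongr
      _ = c0 * (4 / p) ^ a * θ ^ a * (θ * Z) ^ a := by
          rw [Real.mul_rpow (by positivity) (by positivity), Real.mul_rpow hθ.le hZ0]
          ring
      _ ≤ c0 * (4 / p) ^ a * θ ^ a * (a ^ a * Real.exp (θ * Z)) := by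
          gcongr
          exact rpow_le_rpow_self_mul_exp hZ0 ha
      _ = _ := by rw [hNθ]; ring
  have hcosh : Real.cosh (4 * θ) ^ N ≤ Real.exp 8 := by
    calc _ ≤ Real.exp ((4 * θ) ^ 2 / 2) ^ N := by
          gcongr
          exact Real.cosh_le_exp_half_sq _
      _ = Real.exp 8 := by
          rw [← Real.exp_nat_mul]
          congr 1
          linear_combination 8 * hθsq
  have hmoment := integral_exp_centeredDeviation_le (ι := Fin N) (μ := μ) hf hθ.le
  rw [Fintype.card_fin] at hmoment
  calc _ ≤ ∫ s, c0 * (4 / p) ^ a * a ^ a * (N : ℝ) ^ (-(1 + α) / 2) *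
        Real.exp (θ * centeredDeviation μ f s) ∂(Measure.pi fun _ : Fin N => μ) :=
        integral_mono_of_nonneg
          (ae_of_all _ fun s => integral_nonneg fun x => abs_nonneg _)
          ((integrable_exp_mul_of_bound (measurable_centeredDeviation hf) hθ.le
            centeredDeviation_le).const_mul _) (ae_of_all _ hpt)
    _ ≤ c0 * (4 / p) ^ a * a ^ a * (N : ℝ) ^ (-(1 + α) / 2) * (2 * (1 + Real.exp 8)) := by
        rw [integral_const_mul]
        gcongr
        linarith
    _ = _ := by ring
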